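/- Let n > m ≥ 2 be integers and A ⊆ {0,1,…,n−1} × {0,1,…,m−1} a non-empty set with t < n and s < m, and let S = S(A) be the Bedford–McMullen carpet. Then S is uniformly disconnected with constant C = 4·m·n³: for every z ∈ S and every r > 0, every finite sequence z_0 = z, z_1, …, z_N of points of S with |z_i − z_{i+1}| ≤ r/(4·m·n³) for all 0 ≤ i < N satisfies |z_N − z| < r. -/

import Mathlib

open Set Metric Filter

/-- The Assouad dimension of a set `E` in a metric space: the infimum of all `α ≥ 0`
for which there is `C > 0` such that for every `x ∈ E` and all radii `0 < r ≤ R`,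
the set `E ∩ B(x, R)` can be covered by at most `C · (R / r) ^ α` balls of radius `r`. -/
noncomputable def assouadDim {X : Type*} [PseudoMetricSpace X] (E : Set X) : ℝ :=
  sInf { α : ℝ | 0 ≤ α ∧ ∃ C : ℝ, 0 < C ∧ ∀ x ∈ E, ∀ r R : ℝ, 0 < r → r ≤ R →
    ∃ F : Finset X, (F.card : ℝ) ≤ C * (R / r) ^ α ∧
      E ∩ Metric.ball x R ⊆ ⋃ y ∈ F, Metric.ball y r }

/-- The Bedford–McMullen carpet `S(A)` determined by integers `n, m` and
`A ⊆ {0,…,n−1} × {0,…,m−1}`, as a subset of the Euclidean plane. -/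
def bmCarpet (n m : ℕ) (A : Finset (ℕ × ℕ)) : Set (EuclideanSpace ℝ (Fin 2)) :=
  { z | ∃ x y : ℕ → ℕ, (∀ i, (x i, y i) ∈ A) ∧
      z 0 = ∑' i : ℕ, (x i : ℝ) / (n : ℝ) ^ (i + 1) ∧
      z 1 = ∑' i : ℕ, (y i : ℝ) / (m : ℝ) ^ (i + 1) }

/-- `t_j`: the number of elements `(i, j)` of `A` in row `j`. -/
def rowCount (A : Finset (ℕ × ℕ)) (j : ℕ) : ℕ := (A.filter (fun p => p.2 = j)).card

/-- `s`: the number of non-empty rows. -/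
def sVal (m : ℕ) (A : Finset (ℕ × ℕ)) : ℕ :=
  ((Finset.range m).filter (fun j => rowCount A j ≠ 0)).card

/-- `t`: the maximal number of entries in a row. -/
def tVal (m : ℕ) (A : Finset (ℕ × ℕ)) : ℕ :=
  (Finset.range m).sup (fun j => rowCount A j)

/-- The integer with base-`b` digits `d 0, …, d (k - 1)`, most significant digit first. -/
def digitPrefix (b : ℕ) (d : ℕ → ℕ) : ℕ → ℕ
  | 0 => 0
  | k + 1 => b * digitPrefix b d k + d k

lemma digitPrefix_succ (b : ℕ) (d : ℕ → ℕ) (k : ℕ) :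
    digitPrefix b d (k + 1) = b * digitPrefix b d k + d k := rfl

lemma digitPrefix_succ_mod {b : ℕ} {d : ℕ → ℕ} (hd : ∀ i, d i < b) (k : ℕ) :
    digitPrefix b d (k + 1) % b = d k := by
  rw [digitPrefix_succ, Nat.mul_add_mod, Nat.mod_eq_of_lt (hd k)]

lemma digitPrefix_succ_div {b : ℕ} {d : ℕ → ℕ} (hd : ∀ i, d i < b) (k : ℕ) :
    digitPrefix b d (k + 1) / b = digitPrefix b d k := by
  rw [digitPrefix_succ, Nat.mul_add_div (Nat.zero_lt_of_lt (hd k)),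
    Nat.div_eq_of_lt (hd k), add_zero]

lemma digitPrefix_add_div_pow {b : ℕ} {d : ℕ → ℕ} (hd : ∀ i, d i < b) (k j : ℕ) :
    digitPrefix b d (k + j) / b ^ j = digitPrefix b d k := by
  induction j with
  | zero => simp
  | succ j ih =>
    rw [pow_succ', ← Nat.div_div_eq_div_mul, ← add_assoc, digitPrefix_succ_div hd, ih]

lemma digit_eq_digitPrefix_div_mod {b : ℕ} {d : ℕ → ℕ} (hd : ∀ i, d i < b) (k j : ℕ) :
    digitPrefix b d (k + 1 + j) / b ^ j % b = d k := by
  rw [digitPrefix_add_div_pow hd, digitPrefix_succ_mod hd]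

lemma pow_mul_sum_digits {b : ℕ} (hb : b ≠ 0) (d : ℕ → ℕ) (k : ℕ) :
    (b : ℝ) ^ k * ∑ i ∈ Finset.range k, (d i : ℝ) * ((b : ℝ) ^ (i + 1))⁻¹ =
      digitPrefix b d k := by
  have hb' : (b : ℝ) ≠ 0 := by exact_mod_cast hb
  induction k with
  | zero => simp [digitPrefix]
  | succ k ih =>
    rw [Finset.sum_range_succ, mul_add, digitPrefix_succ, pow_succ', mul_assoc, ih]
    push_cast
    field_simp

/-- The value of a digit expansion lies in the closed `b`-adic interval given by its prefix. -/
lemma digitPrefix_le_tsum_le {b : ℕ} {d : ℕ → ℕ} (hd : ∀ i, d i < b) (k : ℕ) :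
    (digitPrefix b d k : ℝ) ≤ (b : ℝ) ^ k * ∑' i : ℕ, (d i : ℝ) / (b : ℝ) ^ (i + 1) ∧
      (b : ℝ) ^ k * ∑' i : ℕ, (d i : ℝ) / (b : ℝ) ^ (i + 1) ≤ digitPrefix b d k + 1 := by
  have hb : b ≠ 0 := Nat.ne_zero_of_lt (hd 0)
  have hb' : (b : ℝ) ^ k ≠ 0 := by positivity
  let e : ℕ → Fin b := fun i => ⟨d i, hd i⟩
  have h : ∑' i : ℕ, (d i : ℝ) / (b : ℝ) ^ (i + 1) = Real.ofDigits e := by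
    simp only [Real.ofDigits, Real.ofDigitsTerm, e, div_eq_mul_inv]
  have hsum := pow_mul_sum_digits hb d k
  have h0 := Real.ofDigits_nonneg fun i => e (i + k)
  have h1 := Real.ofDigits_le_one fun i => e (i + k)
  rw [h, Real.ofDigits_eq_sum_add_ofDigits e k, mul_add, ← mul_assoc, mul_inv_cancel₀ hb', one_mul]
  simp only [Real.ofDigitsTerm, e] at h0 h1 ⊢
  rw [hsum]
  constructor <;> linarith

/-- If `c` avoids the residue `g` modulo `M`, and a larger number lies beyond the next such residue,
then the two differ by at least two. -/
lemma add_two_le_of_block_lt {M g c c' : ℕ} (hg : g < M) (hc : c % M ≠ g)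
    (h : (c + (M - 1 - g)) / M < (c' + (M - 1 - g)) / M) : c + 2 ≤ c' := by
  have hM : 0 < M := by omega
  set K := (c' + (M - 1 - g)) / M
  have h1 : c + (M - 1 - g) < K * M := (Nat.div_lt_iff_lt_mul hM).1 h
  have h2 : K * M ≤ c' + (M - 1 - g) := Nat.div_mul_le_self _ _
  obtain ⟨L, hL⟩ : ∃ L, K = L + 1 := ⟨K - 1, (Nat.sub_add_cancel (Nat.zero_lt_of_lt h)).symm⟩
  rw [hL, add_mul, one_mul] at h1 h2
  have h3 : c ≠ L * M + g := by
    rintro rfl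
    exact hc (by rw [mul_comm, Nat.mul_add_mod, Nat.mod_eq_of_lt hg])
  omega

/-- A chain in a subset of the line with periodic gaps longer than its steps stays in one block. -/
lemma chain_block_eq {M g N : ℕ} {P δ : ℝ} {c : ℕ → ℕ} {w : ℕ → ℝ} (hg : g < M) (hP : 0 < P)
    (hδ : P * δ < 1) (hc : ∀ i ≤ N, c i % M ≠ g)
    (hw : ∀ i ≤ N, (c i : ℝ) ≤ P * w i ∧ P * w i ≤ c i + 1)
    (hstep : ∀ i < N, |w i - w (i + 1)| ≤ δ) :
    ∀ i ≤ N, (c i + (M - 1 - g)) / M = (c 0 + (M - 1 - g)) / M := by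
  intro i hi
  induction i with
  | zero => rfl
  | succ i ih =>
    rw [← ih (by omega)]
    have hs := abs_le.1 (hstep i (by omega))
    have hs1 := mul_le_mul_of_nonneg_left hs.1 hP.le
    have hs2 := mul_le_mul_of_nonneg_left hs.2 hP.le
    have hw0 := hw i (by omega)
    have hw1 := hw (i + 1) hi
    rcases lt_trichotomy ((c (i + 1) + (M - 1 - g)) / M) ((c i + (M - 1 - g)) / M) with h | h | h
    · have h2 : ((c (i + 1) + 2 : ℕ) : ℝ) ≤ c i :=
        Nat.cast_le.2 (add_two_le_of_block_lt hg (hc _ hi) h)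
      push_cast at h2
      linarith
    · exact h
    · have h2 : ((c i + 2 : ℕ) : ℝ) ≤ c (i + 1) :=
        Nat.cast_le.2 (add_two_le_of_block_lt hg (hc _ (by omega)) h)
      push_cast at h2
      linarith

lemma mul_abs_sub_le_of_block_eq {M g c c' : ℕ} {P w w' : ℝ} (hg : g < M) (hP : 0 < P)
    (h : (c + (M - 1 - g)) / M = (c' + (M - 1 - g)) / M)
    (hw : (c : ℝ) ≤ P * w ∧ P * w ≤ c + 1) (hw' : (c' : ℝ) ≤ P * w' ∧ P * w' ≤ c' + 1) :
    P * |w - w'| ≤ M := by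
  have hM : 0 < M := by omega
  have h1 := Nat.div_add_mod (c + (M - 1 - g)) M
  have h2 := Nat.div_add_mod (c' + (M - 1 - g)) M
  have h3 := Nat.mod_lt (c + (M - 1 - g)) hM
  have h4 := Nat.mod_lt (c' + (M - 1 - g)) hM
  rw [h] at h1
  have h5 : ((c + 1 : ℕ) : ℝ) ≤ (c' + M : ℕ) := Nat.cast_le.2 (by omega)
  have h6 : ((c' + 1 : ℕ) : ℝ) ≤ (c + M : ℕ) := Nat.cast_le.2 (by omega)
  push_cast at h5 h6
  have h7 : P * |w - w'| = |P * (w - w')| := by rw [abs_mul, abs_of_pos hP]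
  rw [h7, abs_le]
  constructor <;> linarith

lemma exists_empty_row {m : ℕ} {A : Finset (ℕ × ℕ)} (hs : sVal m A < m) :
    ∃ j < m, ∀ i, (i, j) ∉ A := by
  by_contra! h
  refine hs.not_ge ?_
  rw [sVal, Finset.filter_true_of_mem, Finset.card_range]
  intro j hj
  obtain ⟨i, hi⟩ := h j (Finset.mem_range.1 hj)
  exact Finset.card_ne_zero_of_mem (Finset.mem_filter.2 ⟨hi, rfl⟩)

lemma exists_not_mem_row {n m : ℕ} {A : Finset (ℕ × ℕ)} (ht : tVal m A < n) {j : ℕ} (hj : j < m) :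
    ∃ i < n, (i, j) ∉ A := by
  by_contra! h
  have h1 : rowCount A j ≤ tVal m A :=
    Finset.le_sup (f := fun j => rowCount A j) (Finset.mem_range.2 hj)
  have h2 : n ≤ rowCount A j := by
    rw [rowCount, ← Finset.card_range n]
    refine Finset.card_le_card_of_injOn (fun i => (i, j)) ?_ ?_
    · intro i hi
      simpa using h i (by simpa using hi)
    · intro a _ b _ hab
      exact congrArg Prod.fst hab
  omega

/-- Scales `n ^ (p + 1)` and `m ^ k` adapted to the radius `r`. -/
lemma exists_scales {n m : ℕ} (hm : 2 ≤ m) (hmn : m < n) {r : ℝ} (hr : 0 < r) (hr' : r < 3 / 2) :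
    ∃ p k : ℕ, p + 3 ≤ k ∧ (n : ℝ) ^ p * r ≤ 3 / 2 ∧ 3 / 2 < (n : ℝ) ^ (p + 1) * r ∧
      (m : ℝ) ^ k * r ≤ 2 * n ^ 3 ∧ 2 * (n : ℝ) ^ 3 < m ^ (k + 1) * r := by
  have hm' : (2 : ℝ) ≤ m := by exact_mod_cast hm
  have hn' : (m : ℝ) < n := by exact_mod_cast hmn
  have hn3 : (1 : ℝ) ≤ n ^ 3 := one_le_pow₀ (by linarith)
  obtain ⟨p, hp, hp'⟩ := exists_nat_pow_near (x := 3 / 2 / r) (y := (n : ℝ))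
    ((one_le_div hr).2 hr'.le) (by linarith)
  obtain ⟨k, hk, hk'⟩ := exists_nat_pow_near (x := 2 * (n : ℝ) ^ 3 / r) (y := (m : ℝ))
    ((one_le_div hr).2 (by linarith)) (by linarith)
  rw [le_div_iff₀ hr] at hp hk
  rw [div_lt_iff₀ hr] at hp' hk'
  refine ⟨p, k, ?_, hp, hp', hk, hk'⟩
  have h1 : (n : ℝ) ^ (p + 3) * r < m ^ (k + 1) * r := by
    have := mul_le_mul_of_nonneg_left hp (zero_le_one.trans hn3)
    rw [pow_add]
    nlinarith
  have h2 : (m : ℝ) ^ (p + 3) < m ^ (k + 1) :=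
    (pow_le_pow_left₀ (by linarith) hn'.le _).trans_lt (lt_of_mul_lt_mul_right h1 hr.le)
  have h3 := (pow_lt_pow_iff_right₀ (by linarith : (1 : ℝ) < m)).1 h2
  omega

lemma abs_coord_sub_le_dist (u v : EuclideanSpace ℝ (Fin 2)) (i : Fin 2) :
    |u i - v i| ≤ dist u v := by
  rw [dist_eq_norm, ← PiLp.sub_apply, ← Real.norm_eq_abs]
  exact PiLp.norm_apply_le _ _

/-- If `t < n` and `s < m`, then the Bedford–McMullen carpet `S(A)` is
uniformly disconnected with constant `C = 4 m n³`: for every `z ∈ S`, every `r > 0`, and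
every finite chain `z_0 = z, z_1, …, z_N` in `S` with `|z_i − z_{i+1}| ≤ r / (4 m n³)`,
the endpoint satisfies `|z_N − z| < r`. -/
theorem bm_uniformly_disconnected (n m : ℕ) (hm : 2 ≤ m) (hmn : m < n)
    (A : Finset (ℕ × ℕ)) (hA : A.Nonempty)
    (hAsub : ∀ p ∈ A, p.1 < n ∧ p.2 < m)
    (ht : tVal m A < n) (hs : sVal m A < m)
    (z : EuclideanSpace ℝ (Fin 2)) (hz : z ∈ bmCarpet n m A) (r : ℝ) (hr : 0 < r)
    (N : ℕ) (zs : ℕ → EuclideanSpace ℝ (Fin 2))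
    (hz0 : zs 0 = z)
    (hzsS : ∀ i ≤ N, zs i ∈ bmCarpet n m A)
    (hchain : ∀ i < N, dist (zs i) (zs (i + 1)) ≤ r / (4 * m * n ^ 3)) :
    dist (zs N) z < r := by
  have hm' : (2 : ℝ) ≤ m := by exact_mod_cast hm
  have hn' : (m : ℝ) + 1 ≤ n := by exact_mod_cast hmn
  have hmem : ∀ i, ∃ x y : ℕ → ℕ, i ≤ N → (∀ l, (x l, y l) ∈ A) ∧
      zs i 0 = ∑' l : ℕ, (x l : ℝ) / (n : ℝ) ^ (l + 1) ∧
      zs i 1 = ∑' l : ℕ, (y l : ℝ) / (m : ℝ) ^ (l + 1) := by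
    intro i
    by_cases hi : i ≤ N
    · obtain ⟨x, y, h⟩ := hzsS i hi
      exact ⟨x, y, fun _ => h⟩
    · exact ⟨0, 0, fun h => absurd h hi⟩
  choose x y hxy using hmem
  have hx : ∀ i ≤ N, ∀ l, x i l < n := fun i hi l => (hAsub _ ((hxy i hi).1 l)).1
  have hy : ∀ i ≤ N, ∀ l, y i l < m := fun i hi l => (hAsub _ ((hxy i hi).1 l)).2
  have hx_mem : ∀ k, ∀ i ≤ N, (digitPrefix n (x i) k : ℝ) ≤ (n : ℝ) ^ k * zs i 0 ∧
      (n : ℝ) ^ k * zs i 0 ≤ digitPrefix n (x i) k + 1 := fun k i hi => by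
    rw [(hxy i hi).2.1]
    exact digitPrefix_le_tsum_le (hx i hi) k
  have hy_mem : ∀ k, ∀ i ≤ N, (digitPrefix m (y i) k : ℝ) ≤ (m : ℝ) ^ k * zs i 1 ∧
      (m : ℝ) ^ k * zs i 1 ≤ digitPrefix m (y i) k + 1 := fun k i hi => by
    rw [(hxy i hi).2.2]
    exact digitPrefix_le_tsum_le (hy i hi) k
  have hdist : dist (zs N) z ^ 2 = |zs N 0 - zs 0 0| ^ 2 + |zs N 1 - zs 0 1| ^ 2 := by
    rw [← hz0, EuclideanSpace.dist_sq_eq, Fin.sum_univ_two, Real.dist_eq, Real.dist_eq]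
  refine lt_of_pow_lt_pow_left₀ 2 hr.le ?_
  rw [hdist]
  have ha0 := abs_nonneg (zs N 0 - zs 0 0)
  have ha1 := abs_nonneg (zs N 1 - zs 0 1)
  rcases le_or_gt (3 / 2) r with hr' | hr'
  · have hx0 := hx_mem 0 0 (by omega)
    have hxN := hx_mem 0 N le_rfl
    have hy0 := hy_mem 0 0 (by omega)
    have hyN := hy_mem 0 N le_rfl
    simp only [digitPrefix, Nat.cast_zero, pow_zero, one_mul, zero_add] at hx0 hxN hy0 hyN
    have hb0 : |zs N 0 - zs 0 0| ≤ 1 := by rw [abs_le]; constructor <;> linarith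
    have hb1 : |zs N 1 - zs 0 1| ≤ 1 := by rw [abs_le]; constructor <;> linarith
    nlinarith
  obtain ⟨p, k, hpk, hp, hp', hk, hk'⟩ := exists_scales hm hmn hr hr'
  set δ := r / (4 * m * n ^ 3) with hδ
  have hn0 : (0 : ℝ) < n := by linarith
  have hm0 : (0 : ℝ) < m := by linarith
  obtain ⟨g, hg, hgA⟩ := exists_empty_row hs
  have hblock := chain_block_eq (M := m) (g := g) (N := N) (P := (m : ℝ) ^ (k + 1)) (δ := δ)
    (c := fun i => digitPrefix m (y i) (k + 1)) (w := fun i => zs i 1) hg (by positivity)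
    (by
      rw [hδ, ← mul_div_assoc, div_lt_one (by positivity), pow_succ]
      have : 0 < (m : ℝ) * n ^ 3 := by positivity
      nlinarith [mul_le_mul_of_nonneg_left hk hm0.le])
    (fun i hi => by
      rw [digitPrefix_succ_mod (hy i hi)]
      intro h
      exact hgA _ (h ▸ (hxy i hi).1 k))
    (fun i hi => hy_mem (k + 1) i hi)
    (fun i hi => (abs_coord_sub_le_dist _ _ _).trans (hchain i hi))
  have hdy := mul_abs_sub_le_of_block_eq hg (by positivity) (hblock N le_rfl)
    (hy_mem (k + 1) N le_rfl) (hy_mem (k + 1) 0 (by omega))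
  obtain ⟨j, rfl⟩ := Nat.exists_eq_add_of_le hpk
  set B := (digitPrefix m (y 0) (p + 3 + j + 1) + (m - 1 - g)) / m
  -- The prefixes of length `p + 3 + j` take at most the two values `B` and `B - 1`.
  have hprefix : ∀ i ≤ N, digitPrefix m (y i) (p + 3 + j) = B ∨
      digitPrefix m (y i) (p + 3 + j) = B - 1 := by
    intro i hi
    rw [← hblock i hi, digitPrefix_succ, add_assoc (m * _),
      Nat.mul_add_div (by omega : m > 0)]
    have h1 : (y i (p + 3 + j) + (m - 1 - g)) / m < 2 :=
      (Nat.div_lt_iff_lt_mul (by omega)).2 (by have := hy i hi (p + 3 + j); omega)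
    generalize (y i (p + 3 + j) + (m - 1 - g)) / m = q at h1 ⊢
    omega
  obtain ⟨e, he, heA⟩ := exists_not_mem_row ht
    (Nat.mod_lt ((B - 1) / m ^ (j + 1)) (by omega : 0 < m))
  obtain ⟨f, hf, hfA⟩ := exists_not_mem_row ht (Nat.mod_lt (B / m ^ j) (by omega : 0 < m))
  have hef : n * e + f < n ^ 2 := by nlinarith
  have hblock' := chain_block_eq (M := n ^ 2) (g := n * e + f) (N := N) (P := (n : ℝ) ^ (p + 3))
    (δ := δ) (c := fun i => digitPrefix n (x i) (p + 3)) (w := fun i => zs i 0) hef (by positivity)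
    (by
      rw [hδ, ← mul_div_assoc, div_lt_one (by positivity), pow_add]
      have : 0 < (n : ℝ) ^ 3 := by positivity
      nlinarith [mul_le_mul_of_nonneg_left hp this.le])
    (fun i hi => by
      intro h
      have hlast : x i (p + 2) = f := by
        have := congrArg (· % n) h
        simp only [pow_two, Nat.mod_mul_right_mod, Nat.mul_add_mod, Nat.mod_eq_of_lt hf] at this
        rwa [digitPrefix_succ_mod (hx i hi)] at this
      have hprev : x i (p + 1) = e := by
        have := congrArg (· / n) h
        simp only [pow_two, Nat.mod_mul_right_div_self, Nat.mul_add_div (by omega : n > 0),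
          Nat.div_eq_of_lt hf, add_zero] at this
        rwa [digitPrefix_succ_div (hx i hi), digitPrefix_succ_mod (hx i hi)] at this
      rcases hprefix i hi with hB | hB
      · refine hfA ?_
        rw [← hB, digit_eq_digitPrefix_div_mod (hy i hi) (p + 2) j, ← hlast]
        exact (hxy i hi).1 _
      · refine heA ?_
        rw [← hB, show p + 3 + j = p + 1 + 1 + (j + 1) by omega,
          digit_eq_digitPrefix_div_mod (hy i hi) (p + 1) (j + 1), ← hprev]
        exact (hxy i hi).1 _)
    (fun i hi => hx_mem (p + 3) i hi)
    (fun i hi => (abs_coord_sub_le_dist _ _ _).trans (hchain i hi))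
  have hdx := mul_abs_sub_le_of_block_eq hef (by positivity) (hblock' N le_rfl)
    (hx_mem (p + 3) N le_rfl) (hx_mem (p + 3) 0 (by omega))
  have hX : |zs N 0 - zs 0 0| ≤ 2 / 3 * r := by
    have h1 : (n : ℝ) ^ (p + 1) * |zs N 0 - zs 0 0| ≤ 1 := by
      push_cast at hdx
      rw [show p + 3 = 2 + (p + 1) by omega, pow_add, mul_assoc] at hdx
      exact le_of_mul_le_mul_left (hdx.trans_eq (mul_one _).symm) (by positivity)
    refine le_of_mul_le_mul_left (a := (n : ℝ) ^ (p + 1)) ?_ (by positivity)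
    linarith
  have hY : |zs N 1 - zs 0 1| ≤ 1 / 4 * r := by
    have h2 : (2 : ℝ) * m ≤ n ^ 3 := by nlinarith [mul_pos hn0 hn0]
    refine le_of_mul_le_mul_left (a := (m : ℝ) ^ (p + 3 + j + 1)) ?_ (by positivity)
    linarith
  nlinarith
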